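/- arXiv:1204.5388 — 5 statements merged into one kernel-verified Lean document; each statement's English description precedes it below -/
import Mathlib

section
/- Let w₁, w₂ be nonzero vectors in the Euclidean plane such that for every vector u one has ⟨u, w₁⟩ ≤ 0 if and only if ⟨u, w₂⟩ ≤ 0. Then there exists λ > 0 such that w₂ = λ • w₁. -/
open RealInnerProductSpace

theorem same_sign_implies_pos_collinear (w₁ w₂ : EuclideanSpace ℝ (Fin 2))
    (hw₁ : w₁ ≠ 0) (hw₂ : w₂ ≠ 0)
    (h : ∀ u : EuclideanSpace ℝ (Fin 2), ⟪u, w₁⟫ ≤ 0 ↔ ⟪u, w₂⟫ ≤ 0) :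
    ∃ l : ℝ, 0 < l ∧ w₂ = l • w₁ := by
  have h1 : 0 < ⟪w₁, w₁⟫ := real_inner_self_pos.2 hw₁
  have h2 : 0 < ⟪w₁, w₂⟫ := by
    by_contra hc
    exact absurd ((h w₁).2 (not_lt.1 hc)) (not_le.2 h1)
  obtain ⟨l, hl⟩ : ∃ l : ℝ, l = ⟪w₁, w₂⟫ / ⟪w₁, w₁⟫ := ⟨_, rfl⟩
  have hl' : l * ⟪w₁, w₁⟫ = ⟪w₁, w₂⟫ := by rw [hl, div_mul_cancel₀ _ h1.ne']
  refine ⟨l, hl ▸ div_pos h2 h1, ?_⟩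
  have h3 : ⟪w₂ - l • w₁, w₁⟫ = 0 := by
    rw [inner_sub_left, real_inner_smul_left, hl', real_inner_comm, sub_self]
  have h4 := (h _).1 h3.le
  have h5 : ⟪w₂ - l • w₁, w₂ - l • w₁⟫ ≤ 0 := by
    rw [inner_sub_right, real_inner_smul_right, h3]
    linarith
  exact sub_eq_zero.1 (real_inner_self_nonpos.1 h5)
end

section
/- Let x, y, v, w be vectors in the Euclidean plane with v ≠ 0 and w ≠ 0. Suppose that for every point s in the plane, ⟨x − s, v⟩ < 0 if and only if ⟨y − s, w⟩ < 0 (i.e., a dense binary network gives identical outputs for the state (x, v) and the state (y, w)). Then there exists λ > 0 such that w = λ • v, and moreover ⟨x − y, v⟩ = 0. -/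
open RealInnerProductSpace

theorem indistinguishable_necessary (x y v w : EuclideanSpace ℝ (Fin 2))
    (hv : v ≠ 0) (hw : w ≠ 0)
    (h : ∀ s : EuclideanSpace ℝ (Fin 2), ⟪x - s, v⟫ < 0 ↔ ⟪y - s, w⟫ < 0) :
    (∃ l : ℝ, 0 < l ∧ w = l • v) ∧ ⟪x - y, v⟫ = 0 := by
  have H : ∀ u : EuclideanSpace ℝ (Fin 2), ⟪u, v⟫ < 0 ↔ ⟪y - x, w⟫ + ⟪u, w⟫ < 0 := by
    intro u
    have h1 := h (x - u)
    rw [← inner_add_left]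
    have e1 : x - (x - u) = u := by abel
    have e2 : y - (x - u) = y - x + u := by abel
    rwa [e1, e2] at h1
  have hV : 0 < ⟪v, v⟫ := real_inner_self_pos.2 hv
  obtain ⟨l, hl⟩ : ∃ l : ℝ, l = ⟪w, v⟫ / ⟪v, v⟫ := ⟨_, rfl⟩
  have hp : ⟪w - l • v, v⟫ = 0 := by
    rw [inner_sub_left, real_inner_smul_left, hl]
    field_simp
    ring
  have hpw : ⟪w - l • v, w⟫ = ⟪w - l • v, w - l • v⟫ := by
    rw [inner_sub_right (w - l • v) w, real_inner_smul_right, hp]; ring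
  have hwl : w = l • v := by
    by_contra hne
    have hpos : 0 < ⟪w - l • v, w - l • v⟫ := real_inner_self_pos.2 (sub_ne_zero.2 hne)
    have h2 := (H ((-(⟪y - x, w⟫ + 1) / ⟪w - l • v, w - l • v⟫) • (w - l • v))).2 (by
      rw [real_inner_smul_left, hpw, div_mul_cancel₀ _ hpos.ne']
      linarith)
    rw [real_inner_smul_left, hp] at h2
    linarith
  have hl0 : l ≠ 0 := by
    rintro rfl
    exact hw (by simpa using hwl)
  obtain ⟨c, hc⟩ : ∃ c : ℝ, c = ⟪y - x, w⟫ := ⟨_, rfl⟩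
  have K : ∀ t : ℝ, t < 0 ↔ c + t * l < 0 := by
    intro t
    have h3 := H ((t / ⟪v, v⟫) • v)
    have e : ⟪v, w⟫ = l * ⟪v, v⟫ := by rw [hwl, real_inner_smul_right]
    rw [real_inner_smul_left, real_inner_smul_left, e, ← hc, div_mul_cancel₀ _ hV.ne'] at h3
    have e4 : t / ⟪v, v⟫ * (l * ⟪v, v⟫) = t * l := by field_simp
    rwa [e4] at h3
  have c0 : 0 ≤ c := by
    have := K 0
    simpa using this
  have lpos : 0 < l := by
    by_contra hn
    have hneg : l < 0 := lt_of_le_of_ne (not_lt.1 hn) hl0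
    have h5 := (K (-(c + 1) / l)).2 (by rw [div_mul_cancel₀ _ hl0]; linarith)
    have : 0 < -(c + 1) / l := div_pos_of_neg_of_neg (by linarith) hneg
    linarith
  have cz : c = 0 := by
    by_contra hn
    have cpos : 0 < c := lt_of_le_of_ne c0 (Ne.symm hn)
    have h6 := (K (-c / l)).1 (div_neg_of_neg_of_pos (by linarith) lpos)
    rw [div_mul_cancel₀ _ hl0] at h6
    linarith
  refine ⟨⟨l, lpos, hwl⟩, ?_⟩
  rw [cz, hwl, real_inner_smul_right] at hc
  have h7 : ⟪y - x, v⟫ = 0 := (mul_eq_zero.1 hc.symm).resolve_left hl0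
  rw [← neg_sub, inner_neg_left, h7, neg_zero]
end

section
/- Let x, y : ℝ → ℝ² be differentiable curves in the Euclidean plane and λ : ℝ → ℝ a scalar function such that for every time t, deriv y t = λ t • deriv x t and ⟨x t − y t, deriv x t⟩ = 0. Then the distance between the two trajectories is constant: for all times s and t, ‖x s − y s‖ = ‖x t − y t‖. -/
open RealInnerProductSpace

theorem indistinguishable_constant_distance
    (x y : ℝ → EuclideanSpace ℝ (Fin 2)) (l : ℝ → ℝ)
    (hx : Differentiable ℝ x) (hy : Differentiable ℝ y)
    (hvel : ∀ t, deriv y t = l t • deriv x t)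
    (horth : ∀ t, ⟪x t - y t, deriv x t⟫ = 0) :
    ∀ s t : ℝ, ‖x s - y s‖ = ‖x t - y t‖ := by
  intro s t
  have hd : ∀ u, HasDerivAt (fun u => ‖x u - y u‖ ^ 2) 0 u := by
    intro u
    have h := ((hx u).hasDerivAt.sub (hy u).hasDerivAt).norm_sq
    have h0 : 2 * inner ℝ (x u - y u) (deriv x u - deriv y u) = 0 := by
      rw [hvel u, inner_sub_right, inner_smul_right, horth u]
      simp
    have h' := h.congr_deriv h0
    exact h'
  have h2 : ‖x s - y s‖ ^ 2 = ‖x t - y t‖ ^ 2 :=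
    is_const_of_deriv_eq_zero (fun u => (hd u).differentiableAt) (fun u => (hd u).deriv) s t
  exact (sq_eq_sq₀ (norm_nonneg _) (norm_nonneg _)).mp h2
end

section
/- Let v¹, v², d be vectors in the Euclidean plane and let t₁ < t₁' be real numbers. Assume ⟨d, v¹⟩ = 0 and that for every t in the open interval (t₁, t₁'), both ⟨d + (t − t₁) • (v¹ − v²), v¹⟩ = 0 and ⟨d + (t − t₁) • (v¹ − v²), v²⟩ = 0 hold. Then v¹ = v². Consequently, two indistinguishable 2-leg trajectories sharing the same leg velocities v¹ ≠ v² must have the same maneuver epoch t₁ = t₁'. -/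
open RealInnerProductSpace

theorem two_leg_same_velocity (v₁ v₂ d : EuclideanSpace ℝ (Fin 2))
    (t₁ t₁' : ℝ) (ht : t₁ < t₁')
    (hd : ⟪d, v₁⟫ = 0)
    (h₁ : ∀ t ∈ Set.Ioo t₁ t₁', ⟪d + (t - t₁) • (v₁ - v₂), v₁⟫ = 0)
    (h₂ : ∀ t ∈ Set.Ioo t₁ t₁', ⟪d + (t - t₁) • (v₁ - v₂), v₂⟫ = 0) :
    v₁ = v₂ := by
  have key : ∀ v : EuclideanSpace ℝ (Fin 2),
      (∀ t ∈ Set.Ioo t₁ t₁', ⟪d + (t - t₁) • (v₁ - v₂), v⟫ = 0) → ⟪v₁ - v₂, v⟫ = 0 := by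
    intro v h
    have a := h (t₁ + (t₁' - t₁) / 2) ⟨by linarith, by linarith⟩
    have b := h (t₁ + (t₁' - t₁) / 3) ⟨by linarith, by linarith⟩
    rw [inner_add_left, real_inner_smul_left] at a b
    have c : (t₁' - t₁) * ⟪v₁ - v₂, v⟫ = 0 := by linear_combination 6 * a - 6 * b
    exact (mul_eq_zero.mp c).resolve_left (by linarith)
  have e : ⟪v₁ - v₂, v₁ - v₂⟫ = 0 := by
    rw [inner_sub_right, key v₁ h₁, key v₂ h₂, sub_zero]
  exact sub_eq_zero.mp (inner_self_eq_zero.mp e)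
end

section
/- Let x₀, y₀, uₓ, u_y, aₓ, a_y be vectors in the Euclidean plane and consider the uniformly accelerated trajectories x(t) = x₀ + t • uₓ + (t²/2) • aₓ and y(t) = y₀ + t • u_y + (t²/2) • a_y, with velocities ẋ(t) = uₓ + t • aₓ and ẏ(t) = u_y + t • a_y. Assume that for every time t, ⟨y(t) − x(t), ẏ(t)⟩ = 0 and ⟨y(t) − x(t), ẋ(t)⟩ = 0. Then aₓ = a_y and uₓ = u_y; and if moreover the pair {u_y, a_y} spans the plane (u_y and a_y are linearly independent), then also x₀ = y₀, i.e. the trajectory is fully observable. -/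
open RealInnerProductSpace

theorem sq_sum_aux {a b c d : ℝ} (h : (a - b) ^ 2 + (c - d) ^ 2 = 0) : a = b ∧ c = d := by
  have h1 : (a - b) ^ 2 = 0 := by linarith [sq_nonneg (a - b), sq_nonneg (c - d)]
  have h2 : (c - d) ^ 2 = 0 := by linarith [sq_nonneg (a - b), sq_nonneg (c - d)]
  exact ⟨sub_eq_zero.mp (pow_eq_zero_iff two_ne_zero |>.mp h1),
    sub_eq_zero.mp (pow_eq_zero_iff two_ne_zero |>.mp h2)⟩

theorem accelerated_observability (x₀ y₀ ux uy ax ay : EuclideanSpace ℝ (Fin 2))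
    (h₁ : ∀ t : ℝ,
      ⟪(y₀ + t • uy + (t ^ 2 / 2) • ay) - (x₀ + t • ux + (t ^ 2 / 2) • ax),
        uy + t • ay⟫ = 0)
    (h₂ : ∀ t : ℝ,
      ⟪(y₀ + t • uy + (t ^ 2 / 2) • ay) - (x₀ + t • ux + (t ^ 2 / 2) • ax),
        ux + t • ax⟫ = 0) :
    ax = ay ∧ ux = uy ∧ (LinearIndependent ℝ ![uy, ay] → x₀ = y₀) := by
  simp only [PiLp.inner_apply, Fin.sum_univ_two, PiLp.add_apply, PiLp.sub_apply, PiLp.smul_apply,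
    smul_eq_mul, RCLike.inner_apply, conj_trivial] at h₁ h₂
  have a1 := h₁ 1
  have a2 := h₁ 2
  have a3 := h₁ (-1)
  have a4 := h₁ (-2)
  have b1 := h₂ 1
  have b2 := h₂ 2
  have b3 := h₂ (-1)
  have b4 := h₂ (-2)
  have a0 := h₁ 0
  have ka : (ay 0 - ax 0) ^ 2 + (ay 1 - ax 1) ^ 2 = 0 := by
    linear_combination (1/6) * ((a2 - b2) - 2 * (a1 - b1) + 2 * (a3 - b3) - (a4 - b4))
  have e0 : ay 0 = ax 0 := (sq_sum_aux ka).1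
  have e1 : ay 1 = ax 1 := (sq_sum_aux ka).2
  rw [e0, e1] at a1 a3 b1 b3
  have ku : (uy 0 - ux 0) ^ 2 + (uy 1 - ux 1) ^ 2 = 0 := by
    linear_combination (1/2) * ((a1 - b1) - (a3 - b3))
  have f0 : uy 0 = ux 0 := (sq_sum_aux ku).1
  have f1 : uy 1 = ux 1 := (sq_sum_aux ku).2
  refine ⟨?_, ?_, ?_⟩
  · ext i; fin_cases i
    · exact e0.symm
    · exact e1.symm
  · ext i; fin_cases i
    · exact f0.symm
    · exact f1.symm
  intro hl
  rw [LinearIndependent.pair_iff] at hl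
  have key : ∀ s t : ℝ, s * uy 0 + t * ay 0 = 0 → s * uy 1 + t * ay 1 = 0 → s = 0 ∧ t = 0 := by
    intro s t p q
    apply hl
    ext i; fin_cases i
    · simpa using p
    · simpa using q
  have hd : uy 0 * ay 1 - uy 1 * ay 0 ≠ 0 := by
    intro hd
    have g0 := key (ay 0) (-uy 0) (by ring) (by linear_combination -hd)
    have g1 := key (ay 1) (-uy 1) (by linear_combination hd) (by ring)
    have := key 1 0 (by linarith [g0.2]) (by linarith [g1.2])
    exact one_ne_zero this.1
  have p : (y₀ 0 - x₀ 0) * uy 0 + (y₀ 1 - x₀ 1) * uy 1 = 0 := by linear_combination a0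
  have q : (y₀ 0 - x₀ 0) * ay 0 + (y₀ 1 - x₀ 1) * ay 1 = 0 := by
    rw [f0, f1] at p
    rw [f0, f1] at a1
    rw [e0, e1]
    linear_combination a1 - p
  have r0 : y₀ 0 - x₀ 0 = 0 := by
    apply (mul_eq_zero.mp (_ : (uy 0 * ay 1 - uy 1 * ay 0) * _ = 0)).resolve_left hd
    linear_combination ay 1 * p - uy 1 * q
  have r1 : y₀ 1 - x₀ 1 = 0 := by
    apply (mul_eq_zero.mp (_ : (uy 0 * ay 1 - uy 1 * ay 0) * _ = 0)).resolve_left hd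
    linear_combination uy 0 * q - ay 0 * p
  ext i; fin_cases i
  · exact (sub_eq_zero.mp r0).symm
  · exact (sub_eq_zero.mp r1).symm
end
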